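/- Let 𝐀 be the directed graph with vertex set A = {0,1,2,3,4} and arc set E^𝐀 = {(0,1),(1,0),(2,3),(3,4),(4,2)} (the disjoint union of a directed 2-cycle and a directed 3-cycle). Then there is no polymorphism f : A^L → A of (𝐀,𝐀) (for any L ≥ 1) that is block-symmetric with respect to a partition of [L] into blocks each of size at least 2. -/

import Mathlib

/-- The arc set of the disjoint union of a directed 2-cycle on `{0,1}` and a directed
3-cycle on `{2,3,4}`. -/
def arcs : Set (Fin 5 × Fin 5) := {(0, 1), (1, 0), (2, 3), (3, 4), (4, 2)}

/-- `f` is block-symmetric with respect to the partition of `Fin L` into the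
fibers of `blk`. -/
def IsBlockSymmetric {A B : Type} {L κ : ℕ} (blk : Fin L → Fin κ)
    (f : (Fin L → A) → B) : Prop :=
  ∀ π : Equiv.Perm (Fin L), (∀ i, blk (π i) = blk i) →
    ∀ x : Fin L → A, f (x ∘ π) = f x

/-- There is a permutation of `α` along which some labelling by vertices follows arcs. -/
def HasArcPerm (α : Type) : Prop :=
  ∃ (π : Equiv.Perm α) (x : α → Fin 5), ∀ i, (x i, x (π i)) ∈ arcs

theorem HasArcPerm.congr {α β : Type} (e : α ≃ β) : HasArcPerm α → HasArcPerm β := by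
  rintro ⟨π, x, h⟩
  exact ⟨e.permCongr π, x ∘ e.symm, fun i => by simpa using h (e.symm i)⟩

theorem HasArcPerm.sum {α β : Type} : HasArcPerm α → HasArcPerm β → HasArcPerm (α ⊕ β) := by
  rintro ⟨π, x, h⟩ ⟨ρ, y, k⟩
  refine ⟨π.sumCongr ρ, Sum.elim x y, ?_⟩
  rintro (i | i)
  · simpa using h i
  · simpa using k i

theorem hasArcPerm_fin_two : HasArcPerm (Fin 2) :=
  ⟨finRotate 2, ![0, 1], fun i => by fin_cases i <;> simp [arcs]⟩

theorem hasArcPerm_fin_three : HasArcPerm (Fin 3) :=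
  ⟨finRotate 3, ![2, 3, 4], fun i => by fin_cases i <;> simp [arcs]⟩

theorem hasArcPerm_fin_add_two : ∀ n : ℕ, HasArcPerm (Fin (n + 2))
  | 0 => hasArcPerm_fin_two
  | 1 => hasArcPerm_fin_three
  | n + 2 => ((hasArcPerm_fin_add_two n).sum hasArcPerm_fin_two).congr finSumFinEquiv

theorem hasArcPerm_of_two_le_card {α : Type} [Fintype α] (h : 2 ≤ Fintype.card α) :
    HasArcPerm α := by
  obtain ⟨n, hn⟩ := Nat.exists_eq_add_of_le' h
  exact (hasArcPerm_fin_add_two n).congr (Fintype.equivFinOfCardEq hn).symm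

theorem not_mem_arcs_self (a : Fin 5) : (a, a) ∉ arcs := by
  fin_cases a <;> simp [arcs]

/-- The disjoint union of a directed 2-cycle and a directed 3-cycle
has no polymorphism that is block-symmetric with respect to a partition into blocks
each of size at least 2. -/
theorem stmt_14 :
    ¬ ∃ (L κ : ℕ) (_ : 1 ≤ L) (blk : Fin L → Fin κ)
        (f : (Fin L → Fin 5) → Fin 5),
      (∀ b, 2 ≤ (Finset.univ.filter (fun i => blk i = b)).card) ∧
      (∀ x y : Fin L → Fin 5, (∀ l, (x l, y l) ∈ arcs) → (f x, f y) ∈ arcs) ∧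
      IsBlockSymmetric blk f := by
  rintro ⟨L, κ, -, blk, f, hcard, hpoly, hsymm⟩
  have hfib (b : Fin κ) : HasArcPerm {i // blk i = b} :=
    hasArcPerm_of_two_le_card (by simpa [Fintype.card_subtype] using hcard b)
  choose π x hx using hfib
  let e := Equiv.sigmaFiberEquiv blk
  let ρ : Equiv.Perm (Fin L) := e.permCongr (Equiv.sigmaCongrRight π)
  let y : Fin L → Fin 5 := fun i => x (blk i) ⟨i, rfl⟩
  have hy (b : Fin κ) (i : {i // blk i = b}) : y i = x b i := by
    obtain ⟨i, rfl⟩ := i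
    rfl
  have hρ (i : Fin L) : ρ i = π (blk i) ⟨i, rfl⟩ := rfl
  have harc : (f y, f (y ∘ ρ)) ∈ arcs := hpoly _ _ fun i => by
    rw [Function.comp_apply, hρ, hy]
    exact hx (blk i) ⟨i, rfl⟩
  rw [hsymm ρ (fun i => by rw [hρ]; exact (π (blk i) ⟨i, rfl⟩).2) y] at harc
  exact not_mem_arcs_self _ harc
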